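/- The plain backward-recursion value equals the best guarantee achievable by nonanticipative policies: V₀(∅, ∅) = min over policies π of max_{ω ∈ Ω^T admissible} g(x^π(ω), ω), where a policy π is a family of maps π_t assigning to each history (x_{1:t}, ω_{1:t}) of feasible past decisions and past stage scenarios an element π_t(x_{1:t}, ω_{1:t}) ∈ X_t(x_{1:t}, ω_{1:t}), and x^π(ω) is the decision sequence generated by applying π along the scenario ω. Moreover, the policy defined by greedily choosing at each history a minimizer of x_t ↦ max_{ω_t ∈ Ω_t(ω_{1:t})} V_t attains this minimum. -/

import Mathlib

namespace Multistage

variable {X Ω : Type*}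

/-- Backward-recursion values: `V Xt hX Ωt hΩ g n xs ωs` is the value with `n` remaining
stages at the history `(xs, ωs)`; at `n = 0` it is the terminal objective `g xs ωs`, and
otherwise it is `min_{x ∈ Xt(xs,ωs)} max_{ω ∈ Ωt(ωs)} V (n-1) (xs ++ [x]) (ωs ++ [ω])`. -/
noncomputable def V (Xt : List X → List Ω → Finset X)
    (hX : ∀ xs ωs, (Xt xs ωs).Nonempty)
    (Ωt : List Ω → Finset Ω) (hΩ : ∀ ωs, (Ωt ωs).Nonempty)
    (g : List X → List Ω → ℝ) : ℕ → List X → List Ω → ℝ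
  | 0, xs, ωs => g xs ωs
  | n + 1, xs, ωs =>
      (Xt xs ωs).inf' (hX xs ωs) fun x =>
        (Ωt ωs).sup' (hΩ ωs) fun ω =>
          V Xt hX Ωt hΩ g n (xs ++ [x]) (ωs ++ [ω])

/-- The finite set of admissible scenario continuations of length `n` after the partial
scenario `past`: each stage scenario is drawn from `Ωt` applied to the current partial
scenario. -/
noncomputable def scens [DecidableEq Ω] (Ωt : List Ω → Finset Ω) :
    ℕ → List Ω → Finset (List Ω)
  | 0, _ => {[]}
  | n + 1, past =>
      (Ωt past).biUnion fun ω =>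
        (scens Ωt n (past ++ [ω])).image fun rest => ω :: rest

theorem scens_nonempty [DecidableEq Ω] (Ωt : List Ω → Finset Ω)
    (hΩ : ∀ ωs, (Ωt ωs).Nonempty) :
    ∀ (n : ℕ) (past : List Ω), (scens Ωt n past).Nonempty := by
  intro n
  induction n with
  | zero => intro past; exact ⟨[], by simp [scens]⟩
  | succ n ih =>
      intro past
      obtain ⟨ω, hω⟩ := hΩ past
      obtain ⟨rest, hrest⟩ := ih (past ++ [ω])
      exact ⟨ω :: rest, Finset.mem_biUnion.mpr ⟨ω, hω, Finset.mem_image.mpr ⟨rest, hrest, rfl⟩⟩⟩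

/-- The decision sequence generated by applying the policy `π` along the remaining
scenario list, starting from the history `(xs, past)`: the stage decision is taken first,
then the stage scenario is revealed. -/
def playAux (π : List X → List Ω → X) : List X → List Ω → List Ω → List X
  | _, _, [] => []
  | xs, past, ω :: rest =>
      π xs past :: playAux π (xs ++ [π xs past]) (past ++ [ω]) rest

/-- `play π ωs` is the decision sequence generated by the policy `π` in the scenario `ωs`. -/
def play (π : List X → List Ω → X) (ωs : List Ω) : List X :=
  playAux π [] [] ωs

/-- The worst-case objective value of the policy `π` over the `n` stages that follow the
history `(xs, past)`. -/
noncomputable def guarantee [DecidableEq Ω] (Ωt : List Ω → Finset Ω)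
    (hΩ : ∀ ωs, (Ωt ωs).Nonempty) (g : List X → List Ω → ℝ) (π : List X → List Ω → X)
    (n : ℕ) (xs : List X) (past : List Ω) : ℝ :=
  (scens Ωt n past).sup' (scens_nonempty Ωt hΩ n past) fun rest =>
    g (xs ++ playAux π xs past rest) (past ++ rest)

theorem guarantee_zero [DecidableEq Ω] (Ωt : List Ω → Finset Ω)
    (hΩ : ∀ ωs, (Ωt ωs).Nonempty) (g : List X → List Ω → ℝ) (π : List X → List Ω → X)
    (xs : List X) (past : List Ω) :
    guarantee Ωt hΩ g π 0 xs past = g xs past := by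
  simp [guarantee, scens, playAux]

theorem guarantee_succ [DecidableEq Ω] (Ωt : List Ω → Finset Ω)
    (hΩ : ∀ ωs, (Ωt ωs).Nonempty) (g : List X → List Ω → ℝ) (π : List X → List Ω → X)
    (n : ℕ) (xs : List X) (past : List Ω) :
    guarantee Ωt hΩ g π (n + 1) xs past =
      (Ωt past).sup' (hΩ past) fun ω =>
        guarantee Ωt hΩ g π n (xs ++ [π xs past]) (past ++ [ω]) := by
  refine eq_of_forall_ge_iff fun c => ?_
  simp only [guarantee, scens, Finset.sup'_le_iff, Finset.mem_biUnion, Finset.mem_image,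
    List.append_assoc, List.singleton_append]
  constructor
  · exact fun h ω hω rest hrest => h _ ⟨ω, hω, rest, hrest, rfl⟩
  · rintro h _ ⟨ω, hω, rest, hrest, rfl⟩
    exact h ω hω rest hrest

/-- No feasible policy guarantees less than the backward-recursion value. -/
theorem V_le_guarantee [DecidableEq Ω]
    (Xt : List X → List Ω → Finset X) (hX : ∀ xs ωs, (Xt xs ωs).Nonempty)
    (Ωt : List Ω → Finset Ω) (hΩ : ∀ ωs, (Ωt ωs).Nonempty)
    (g : List X → List Ω → ℝ) (π : List X → List Ω → X)
    (hπ : ∀ xs ωs, π xs ωs ∈ Xt xs ωs) (n : ℕ) (xs : List X) (past : List Ω) :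
    V Xt hX Ωt hΩ g n xs past ≤ guarantee Ωt hΩ g π n xs past := by
  induction n generalizing xs past with
  | zero => rw [V, guarantee_zero]
  | succ n ih =>
      rw [V, guarantee_succ]
      exact (Finset.inf'_le _ (hπ xs past)).trans
        (Finset.sup'_mono_fun fun ω _ => ih _ _)

/-- A policy that is greedy at each history for the number of stages remaining there
guarantees the backward-recursion value. -/
theorem guarantee_eq_V [DecidableEq Ω] (T : ℕ)
    (Xt : List X → List Ω → Finset X) (hX : ∀ xs ωs, (Xt xs ωs).Nonempty)
    (Ωt : List Ω → Finset Ω) (hΩ : ∀ ωs, (Ωt ωs).Nonempty)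
    (g : List X → List Ω → ℝ) (π : List X → List Ω → X)
    (hπ : ∀ (xs : List X) (ωs : List Ω) (n : ℕ), ωs.length + (n + 1) = T →
      ((Ωt ωs).sup' (hΩ ωs) fun ω =>
          V Xt hX Ωt hΩ g n (xs ++ [π xs ωs]) (ωs ++ [ω])) =
        (Xt xs ωs).inf' (hX xs ωs) fun x =>
          (Ωt ωs).sup' (hΩ ωs) fun ω =>
            V Xt hX Ωt hΩ g n (xs ++ [x]) (ωs ++ [ω]))
    (n : ℕ) (xs : List X) (past : List Ω) (hn : past.length + n = T) :
    guarantee Ωt hΩ g π n xs past = V Xt hX Ωt hΩ g n xs past := by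
  induction n generalizing xs past with
  | zero => rw [V, guarantee_zero]
  | succ n ih =>
      rw [V, guarantee_succ, ← hπ xs past n hn]
      exact Finset.sup'_congr _ rfl fun ω _ => ih _ _ (by simp; omega)

/-- The backward-recursion value is the least guarantee of a feasible policy. -/
theorem isLeast_V [DecidableEq Ω] (T : ℕ)
    (Xt : List X → List Ω → Finset X) (hX : ∀ xs ωs, (Xt xs ωs).Nonempty)
    (Ωt : List Ω → Finset Ω) (hΩ : ∀ ωs, (Ωt ωs).Nonempty)
    (g : List X → List Ω → ℝ) :
    IsLeast
      { w : ℝ | ∃ π : List X → List Ω → X,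
          (∀ xs ωs, π xs ωs ∈ Xt xs ωs) ∧ w = guarantee Ωt hΩ g π T [] [] }
      (V Xt hX Ωt hΩ g T [] []) := by
  constructor
  · choose π hπF hπO using fun xs ωs =>
      Finset.exists_mem_eq_inf' (hX xs ωs) fun x =>
        (Ωt ωs).sup' (hΩ ωs) fun ω =>
          V Xt hX Ωt hΩ g (T - (ωs.length + 1)) (xs ++ [x]) (ωs ++ [ω])
    refine ⟨π, hπF, (guarantee_eq_V T Xt hX Ωt hΩ g π ?_ T [] [] (by simp)).symm⟩
    intro xs ωs n hn
    obtain rfl : n = T - (ωs.length + 1) := by omega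
    exact (hπO xs ωs).symm
  · rintro _ ⟨π, hπ, rfl⟩
    exact V_le_guarantee Xt hX Ωt hΩ g π hπ T [] []

/-- Correspondence theorem: the plain backward-recursion value `V T [] []` is the least
worst-case objective value achievable by nonanticipative feasible policies, and any
greedy policy (choosing at each history a minimizer of
`x ↦ max_{ω ∈ Ωt(ωs)} V n (xs ++ [x]) (ωs ++ [ω])`) attains this minimum. -/
theorem correspondence [Fintype X] [Fintype Ω] [DecidableEq Ω]
    (T : ℕ) (hT : 1 ≤ T)
    (Xt : List X → List Ω → Finset X) (hX : ∀ xs ωs, (Xt xs ωs).Nonempty)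
    (Ωt : List Ω → Finset Ω) (hΩ : ∀ ωs, (Ωt ωs).Nonempty)
    (g : List X → List Ω → ℝ)
    (πg : List X → List Ω → X)
    (hπgF : ∀ xs ωs, πg xs ωs ∈ Xt xs ωs)
    (hπgO : ∀ (xs : List X) (ωs : List Ω) (n : ℕ),
      ((Ωt ωs).sup' (hΩ ωs) fun ω =>
          V Xt hX Ωt hΩ g n (xs ++ [πg xs ωs]) (ωs ++ [ω])) =
        (Xt xs ωs).inf' (hX xs ωs) fun x =>
          (Ωt ωs).sup' (hΩ ωs) fun ω =>
            V Xt hX Ωt hΩ g n (xs ++ [x]) (ωs ++ [ω])) :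
    IsLeast
      { w : ℝ | ∃ π : List X → List Ω → X,
          (∀ xs ωs, π xs ωs ∈ Xt xs ωs) ∧
          w = (scens Ωt T []).sup' (scens_nonempty Ωt hΩ T [])
                fun ωs => g (play π ωs) ωs }
      (V Xt hX Ωt hΩ g T [] []) ∧
    ((scens Ωt T []).sup' (scens_nonempty Ωt hΩ T []) fun ωs => g (play πg ωs) ωs) =
      V Xt hX Ωt hΩ g T [] [] := by
  exact ⟨isLeast_V T Xt hX Ωt hΩ g,
    guarantee_eq_V T Xt hX Ωt hΩ g πg (fun xs ωs n _ => hπgO xs ωs n) T [] [] (by simp)⟩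

end Multistage
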